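/- Let f, h : ℝ² → ℝ² be commuting lifts of commuting torus homeomorphisms f̄, h̄ homotopic to the identity. If f is (0,1)-annular (i.e. |Pr₁(fⁿ(z) − z)| ≤ M for all z, n) and the deviation of h in the direction (1,0) is unbounded, then the total deviation of f is finite: de(f) = sup_{n,x,y} ‖(fⁿ(x)−x) − (fⁿ(y)−y)‖ < ∞. -/

import Mathlib

open Filter Topology MeasureTheory

noncomputable section

/-- The plane ℝ². -/
abbrev V2 : Type := ℝ × ℝ

/-- Euclidean dot product on ℝ². -/
def dot (x y : V2) : ℝ := x.1 * y.1 + x.2 * y.2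

/-- Euclidean norm on ℝ². -/
def nrm (x : V2) : ℝ := Real.sqrt (dot x x)

/-- v^⊥ = (−v₂, v₁). -/
def perp (v : V2) : V2 := (-v.2, v.1)

/-- Inclusion of ℤ² into ℝ². -/
def intVec (u : ℤ × ℤ) : V2 := ((u.1 : ℝ), (u.2 : ℝ))

/-- `f` is a lift of a torus map: it commutes with all integer translations. -/
def IsLift (f : V2 → V2) : Prop := ∀ (z : V2) (u : ℤ × ℤ), f (z + intVec u) = f z + intVec u

/-- The Misiurewicz–Ziemian rotation set of `f`. -/
def RotSet (f : V2 → V2) : Set V2 :=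
  {v | ∃ (n : ℕ → ℕ) (x : ℕ → V2), Tendsto n atTop atTop ∧
    Tendsto (fun i => ((n i : ℝ))⁻¹ • (f^[n i] (x i) - x i)) atTop (𝓝 v)}


lemma seg_branch (θ : ℝ → ℝ) (hθ : Continuous θ) (hc : ∀ t, 0 < Real.cos (θ t)) :
    ∃ k : ℤ, ∀ t, |θ t - 2 * k * Real.pi| < Real.pi / 2 := by
  have hπ := Real.pi_pos
  refine ⟨round (θ 0 / (2 * Real.pi)), ?_⟩
  set k : ℤ := round (θ 0 / (2 * Real.pi)) with hk
  set η : ℝ → ℝ := fun t => θ t - 2 * k * Real.pi with hη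
  have hηc : Continuous η := by fun_prop
  have hcos : ∀ t, 0 < Real.cos (η t) := by
    intro t
    have : Real.cos (η t) = Real.cos (θ t) := by
      have := Real.cos_sub_int_mul_two_pi (θ t) k
      rw [← this, hη]; congr 1; ring
    rw [this]; exact hc t
  have h0 : |η 0| ≤ Real.pi := by
    have := abs_sub_round (θ 0 / (2 * Real.pi))
    rw [← hk] at this
    have e : η 0 = (θ 0 / (2 * Real.pi) - k) * (2 * Real.pi) := by
      simp only [hη]; field_simp
    rw [e, abs_mul, abs_of_pos (by positivity : 0 < 2 * Real.pi)]
    nlinarith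
  have hbad : ∀ t, |η t| ≠ Real.pi / 2 := by
    intro t ht
    have := hcos t
    rw [← Real.cos_abs, ht, Real.cos_pi_div_two] at this
    exact lt_irrefl _ this
  have h0' : |η 0| < Real.pi / 2 := by
    by_contra hcon
    push Not at hcon
    have := hcos 0
    rw [← Real.cos_abs] at this
    have := Real.cos_nonpos_of_pi_div_two_le_of_le hcon (by linarith)
    linarith
  intro t
  by_contra hcon
  push Not at hcon
  have := mem_range_of_exists_le_of_exists_ge (f := fun t => |η t|) (c := Real.pi / 2)
    hηc.abs ⟨0, h0'.le⟩ ⟨t, hcon⟩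
  obtain ⟨s, hs⟩ := this
  exact hbad s hs

lemma exists_clog (F : ℝ × ℝ → ℂ) (hF : Continuous F) (h0 : ∀ z, F z ≠ 0) :
    ∃ L : ℝ × ℝ → ℂ, Continuous L ∧ ∀ z, Complex.exp (L z) = F z := by
  have he : Complex.exp (Complex.log (F 0)) = F 0 := Complex.exp_log (h0 0)
  obtain ⟨L, ⟨-, hL⟩, -⟩ := Complex.isCoveringMapOn_exp.existsUnique_continuousMap_lifts
    (f := (⟨F, hF⟩ : C(ℝ × ℝ, ℂ))) (a₀ := 0) (e₀ := Complex.log (F 0)) he h0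
  exact ⟨L, L.continuous, fun z => congrFun hL z⟩

lemma int_eq_of_abs (a b : ℤ) (θ c d : ℝ) (h1 : |θ - c - 2 * a * Real.pi| < Real.pi / 2)
    (h2 : |θ - d - 2 * b * Real.pi| < Real.pi / 2) (hcd : c - d = Real.pi / 2) : a = b := by
  have hπ := Real.pi_pos
  rw [abs_lt] at h1 h2
  have e1 : ((a : ℝ) - b) < 1 := by nlinarith
  have e2 : (-1 : ℝ) < ((a : ℝ) - b) := by nlinarith
  have e1' : a - b < 1 := by exact_mod_cast e1
  have e2' : -1 < a - b := by exact_mod_cast e2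
  omega

lemma crossing (γ α : ℝ → ℝ × ℝ) (hγ : Continuous γ) (hα : Continuous α) (N : ℝ)
    (hl : ∀ t, (γ (-N)).1 < (α t).1) (hr : ∀ t, (α t).1 < (γ N).1)
    (hb : ∀ s, (α 0).2 < (γ s).2) (ht : ∀ s, (γ s).2 < (α 1).2) :
    ∃ s t, γ s = α t := by
  by_contra hcon
  push Not at hcon
  let F : ℝ × ℝ → ℂ := fun z =>
    (((γ z.1).1 - (α z.2).1 : ℝ) : ℂ) + (((γ z.1).2 - (α z.2).2 : ℝ) : ℂ) * Complex.I
  have hF : Continuous F := by fun_prop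
  have hre : ∀ z, (F z).re = (γ z.1).1 - (α z.2).1 := by intro z; simp [F]
  have him : ∀ z, (F z).im = (γ z.1).2 - (α z.2).2 := by intro z; simp [F]
  have h0 : ∀ z, F z ≠ 0 := by
    intro z hz
    apply hcon z.1 z.2
    have h1 := hre z
    have h2 := him z
    rw [hz] at h1 h2
    simp at h1 h2
    ext <;> linarith
  obtain ⟨L, hLc, hL⟩ := exists_clog F hF h0
  let θ : ℝ × ℝ → ℝ := fun z => (L z).im
  have hθ : Continuous θ := by fun_prop
  have hcos : ∀ z, Real.exp (L z).re * Real.cos (θ z) = (γ z.1).1 - (α z.2).1 := by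
    intro z; rw [← hre, ← hL, Complex.exp_re]
  have hsin : ∀ z, Real.exp (L z).re * Real.sin (θ z) = (γ z.1).2 - (α z.2).2 := by
    intro z; rw [← him, ← hL, Complex.exp_im]
  have hex : ∀ z, 0 < Real.exp (L z).re := fun z => Real.exp_pos _
  obtain ⟨k1, hk1⟩ := seg_branch (fun s => θ (s, 0) - Real.pi / 2) (by fun_prop) (by
    intro s
    rw [Real.cos_sub_pi_div_two]
    refine (pos_iff_pos_of_mul_pos (a := Real.exp (L (s,0)).re) ?_).1 (hex _)
    rw [hsin]; linarith [hb s])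
  obtain ⟨k2, hk2⟩ := seg_branch (fun t => θ (N, t) - 0) (by fun_prop) (by
    intro t
    rw [sub_zero]
    refine (pos_iff_pos_of_mul_pos (a := Real.exp (L (N,t)).re) ?_).1 (hex _)
    rw [hcos]; linarith [hr t])
  obtain ⟨k3, hk3⟩ := seg_branch (fun s => θ (s, 1) - (-(Real.pi / 2))) (by fun_prop) (by
    intro s
    rw [sub_neg_eq_add, Real.cos_add_pi_div_two]
    refine (pos_iff_pos_of_mul_pos (a := Real.exp (L (s,1)).re) ?_).1 (hex _)
    rw [mul_neg, hsin]; linarith [ht s])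
  obtain ⟨k4, hk4⟩ := seg_branch (fun t => θ (-N, t) - (-Real.pi)) (by fun_prop) (by
    intro t
    rw [sub_neg_eq_add, Real.cos_add_pi]
    refine (pos_iff_pos_of_mul_pos (a := Real.exp (L (-N,t)).re) ?_).1 (hex _)
    rw [mul_neg, hcos]; linarith [hl t])
  have e1 := int_eq_of_abs k1 k2 _ _ _ (hk1 N) (hk2 0) (by ring)
  have e2 := int_eq_of_abs k2 k3 _ _ _ (hk2 1) (hk3 N) (by ring)
  have e3 := int_eq_of_abs k3 k4 _ _ _ (hk3 (-N)) (hk4 1) (by ring)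
  have a1 := hk1 (-N)
  have a2 := hk4 0
  subst e1 e2 e3
  rw [abs_lt] at a1 a2
  linarith [a1.1, a1.2, a2.1, a2.2, Real.pi_pos]

lemma block (g gi : V2 → V2) (hg : Continuous g) (hgi : ∀ z, gi (g z) = z)
    (hgi' : ∀ z, g (gi z) = z) (hlg : IsLift g) (D : ℝ)
    (hD1 : ∀ z, |(g z - z).1| ≤ D) (hD2 : ∀ z, |(g z - z).2| ≤ D)
    (a b : ℝ) (y : V2) (hy : b ≤ y.1) (hgy : (g y).1 ≤ a)
    (α : ℝ → V2) (hα : Continuous α) (ha : ∀ t, a < (α t).1) (hb : ∀ t, (gi (α t)).1 < b) :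
    (α 1).2 - (α 0).2 ≤ 2 * D + 2 := by
  by_contra hcon
  push Not at hcon
  have hD0 : 0 ≤ D := (abs_nonneg _).trans (hD1 0)
  set v : ℤ := ⌊(α 0).2 + D - y.2⌋ + 1 with hv
  have hv1 : (α 0).2 + D - y.2 < v := by rw [hv]; push_cast; exact Int.lt_floor_add_one _
  have hv2 : (v : ℝ) ≤ (α 0).2 + D - y.2 + 1 := by
    rw [hv]; push_cast; linarith [Int.floor_le ((α 0).2 + D - y.2)]
  set y' : V2 := y + intVec (0, v) with hy'
  have y1 : y'.1 = y.1 := by simp [hy', intVec]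
  have y2 : y'.2 = y.2 + v := by simp [hy', intVec]
  have gy1 : (g y').1 = (g y).1 := by rw [hy', hlg]; simp [intVec]
  let γ : ℝ → V2 := fun s => g (y' + (max s 0, 0)) + (min s 0, 0)
  have hγ : Continuous γ := by fun_prop
  have hγ2 : ∀ s, |(γ s).2 - y'.2| ≤ D := by
    intro s
    have := hD2 (y' + (max s 0, 0))
    simpa [γ] using this
  have hN : (0:ℝ) < 2 * D + 1 := by linarith
  obtain ⟨s, t, hst⟩ := crossing γ α hγ hα (2 * D + 1)
    (by
      intro t
      have e : γ (-(2 * D + 1)) = g y' + (-(2 * D + 1), 0) := by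
        simp only [γ]
        rw [max_eq_right (by linarith), min_eq_left (by linarith)]
        congr 2
        ext <;> simp
      rw [e]
      simp only [Prod.fst_add]
      linarith [ha t])
    (by
      intro t
      have e : γ (2 * D + 1) = g (y' + (2 * D + 1, 0)) := by
        simp only [γ]
        rw [max_eq_left (by linarith), min_eq_right (by linarith)]
        ext <;> simp
      rw [e]
      have h1 := hD1 (y' + (2 * D + 1, 0))
      have h2 := hD1 (gi (α t))
      rw [hgi'] at h2
      simp only [Prod.fst_sub, Prod.fst_add, abs_le] at h1 h2
      linarith [hb t, h1.1, h2.2])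
    (by
      intro s
      have := (abs_le.1 (hγ2 s)).1
      linarith)
    (by
      intro s
      have := (abs_le.1 (hγ2 s)).2
      linarith)
  rcases le_total s 0 with hs | hs
  · have e : γ s = g y' + (s, 0) := by
      simp only [γ]
      rw [max_eq_right hs, min_eq_left hs]
      congr 2
      ext <;> simp
    have := ha t
    rw [← hst, e] at this
    simp only [Prod.fst_add] at this
    linarith
  · have e : γ s = g (y' + (s, 0)) := by
      simp only [γ]
      rw [max_eq_left hs, min_eq_right hs]
      ext <;> simp
    have := hb t
    rw [← hst, e, hgi] at this
    simp only [Prod.fst_add] at this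
    linarith

lemma local_bound (g gi : V2 → V2) (hg : Continuous g) (hgic : Continuous gi)
    (hgi : ∀ z, gi (g z) = z)
    (hgi' : ∀ z, g (gi z) = z) (hlg : IsLift g) (D : ℝ)
    (hD1 : ∀ z, |(g z - z).1| ≤ D) (hD2 : ∀ z, |(g z - z).2| ≤ D)
    (F : ℤ → V2 → V2) (hF : ∀ n, Continuous (F n)) (hFg : ∀ n z, gi (F n z) = F n (gi z))
    (M : ℝ) (hM : ∀ n z, |(F n z - z).1| ≤ M) (y z : V2)
    (hyz : (g y - y).1 + 2 * M + 2 < (z - gi z).1) :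
    ∀ᶠ w in 𝓝 z, ∀ n, |(F n z - F n w).2| ≤ 2 * D + 2 := by
  set p := gi z with hp
  have hU : {q : V2 | z.1 - 1/4 < q.1 ∧ (gi q).1 < p.1 + 1/4} ∈ 𝓝 z := by
    apply IsOpen.mem_nhds
    · have o1 : IsOpen {q : V2 | z.1 - 1/4 < q.1} := isOpen_lt continuous_const continuous_fst
      have o2 : IsOpen {q : V2 | (gi q).1 < p.1 + 1/4} :=
        isOpen_lt (continuous_fst.comp hgic) continuous_const
      exact o1.inter o2
    · constructor
      · linarith
      · rw [← hp]; linarith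
  obtain ⟨ε, hε, hball⟩ := Metric.mem_nhds_iff.1 hU
  simp only [Prod.fst_sub] at hyz
  set u : ℤ := ⌈p.1 + 1/4 + M - y.1⌉ with hu
  have hu1 : p.1 + 1/4 + M - y.1 ≤ u := Int.le_ceil _
  have hu2 : (u : ℝ) < p.1 + 1/4 + M - y.1 + 1 := Int.ceil_lt_add_one _
  filter_upwards [Metric.ball_mem_nhds z hε] with w hw n
  have key : ∀ α : ℝ → V2, Continuous α → (∀ t, α t ∈ Metric.ball z ε) →
      (F n (α 1)).2 - (F n (α 0)).2 ≤ 2 * D + 2 := by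
    intro α hα hαb
    refine block g gi hg hgi hgi' hlg D hD1 hD2 (z.1 - 1/4 - M) (p.1 + 1/4 + M)
      (y + intVec (u, 0)) ?_ ?_ (fun t => F n (α t)) ((hF n).comp hα) ?_ ?_
    · simp [intVec]; linarith
    · rw [hlg]; simp [intVec]; linarith
    · intro t
      have h1 := (hball (hαb t)).1
      have h2 := (abs_le.1 (hM n (α t))).1
      simp only [Prod.fst_sub] at h2
      show _ < (F n (α t)).1
      linarith
    · intro t
      have h1 := (hball (hαb t)).2
      have h2 := (abs_le.1 (hM n (gi (α t)))).2
      simp only [Prod.fst_sub] at h2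
      show (gi (F n (α t))).1 < _
      rw [hFg]
      linarith
  have hc : ∀ x y : V2, x ∈ Metric.ball z ε → y ∈ Metric.ball z ε →
      (F n y).2 - (F n x).2 ≤ 2 * D + 2 := by
    intro x y hx hy
    have := key (fun t => AffineMap.lineMap x y (max 0 (min 1 t)))
      (by simp only [AffineMap.lineMap_apply_module]; fun_prop) (by
        intro t
        exact (convex_ball z ε).lineMap_mem hx hy ⟨le_max_left _ _, max_le (by norm_num) (min_le_left _ _)⟩)
    simpa using this
  rw [abs_le]
  have h1 := hc z w (Metric.mem_ball_self hε) hw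
  have h2 := hc w z hw (Metric.mem_ball_self hε)
  simp only [Prod.snd_sub]
  constructor <;> linarith

lemma floor_red (z : V2) : ∃ u : ℤ × ℤ, z + intVec u ∈ Set.Icc (0 : V2) 1 := by
  refine ⟨(-⌊z.1⌋, -⌊z.2⌋), ?_⟩
  have a1 := Int.floor_le z.1
  have a2 := Int.lt_floor_add_one z.1
  have b1 := Int.floor_le z.2
  have b2 := Int.lt_floor_add_one z.2
  simp only [Set.mem_Icc, Prod.le_def, intVec, Prod.fst_add, Prod.snd_add, Prod.fst_zero,
    Prod.snd_zero, Prod.fst_one, Prod.snd_one]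
  push_cast
  refine ⟨⟨?_, ?_⟩, ?_, ?_⟩ <;> linarith

lemma disp_bdd (g : V2 → V2) (hg : Continuous g) (hlg : IsLift g) :
    ∃ D : ℝ, ∀ z, ‖g z - z‖ ≤ D := by
  obtain ⟨D, hD⟩ := (isCompact_Icc (a := (0 : V2)) (b := 1)).exists_bound_of_continuousOn
    (f := fun z => g z - z) (by fun_prop)
  refine ⟨D, fun z => ?_⟩
  obtain ⟨u, hu⟩ := floor_red z
  have := hD _ hu
  rw [hlg] at this
  simpa using this

lemma glob (F : ℤ → V2 → V2) (hl : ∀ n, IsLift (F n)) (K : ℝ)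
    (hloc : ∀ z, ∀ᶠ w in 𝓝 z, ∀ n, |(F n z - F n w).2| ≤ K) :
    ∃ K' : ℝ, ∀ n x y, |((F n x - x) - (F n y - y)).2| ≤ K' := by
  have h1 : ∀ z, ∃ ε > 0, ∀ w ∈ Metric.ball z ε, ∀ n, |(F n z - F n w).2| ≤ K := by
    intro z
    obtain ⟨ε, h, h'⟩ := Metric.eventually_nhds_iff_ball.1 (hloc z)
    exact ⟨ε, h, h'⟩
  choose ε hε hball using h1
  obtain ⟨δ, hδ, hδ'⟩ := lebesgue_number_lemma_of_metric (isCompact_Icc (a := (0 : V2)) (b := 1))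
    (c := fun z => Metric.ball z (ε z)) (fun z => Metric.isOpen_ball)
    (fun z _ => Set.mem_iUnion.2 ⟨z, Metric.mem_ball_self (hε z)⟩)
  have h2 : ∀ z w : V2, dist w z < δ → ∀ n, |(F n z).2 - (F n w).2| ≤ 2 * K := by
    intro z w hzw n
    obtain ⟨u, hu⟩ := floor_red z
    obtain ⟨c, hc⟩ := hδ' _ hu
    have e1 := hball c _ (hc (Metric.mem_ball_self hδ)) n
    have e2 := hball c (w + intVec u) (hc (by simpa [Metric.mem_ball] using hzw)) n
    rw [hl] at e1 e2
    simp only [Prod.snd_sub, Prod.snd_add, abs_le] at e1 e2 ⊢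
    constructor <;> linarith [e1.1, e1.2, e2.1, e2.2]
  obtain ⟨N, hN⟩ := exists_nat_gt (1 / δ)
  have hN0 : (0:ℝ) < N := lt_trans (by positivity) hN
  have h3 : ∀ x y : V2, ‖y - x‖ ≤ 1 → ∀ n, |(F n x).2 - (F n y).2| ≤ N * (2 * K) := by
    intro x y hxy n
    have ind : ∀ k : ℕ, |(F n x).2 - (F n (x + ((k : ℝ) / N) • (y - x))).2| ≤ k * (2 * K) := by
      intro k
      induction k with
      | zero => simp
      | succ k ih =>
        have st := h2 (x + ((k : ℝ) / N) • (y - x)) (x + (((k + 1 : ℕ) : ℝ) / N) • (y - x)) (by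
          rw [dist_add_left, dist_eq_norm, ← sub_smul, norm_smul]
          have : (((k + 1 : ℕ) : ℝ) / N) - (k : ℝ) / N = 1 / N := by push_cast; ring
          rw [this, Real.norm_of_nonneg (by positivity)]
          have : 1 / (N : ℝ) < δ := by
            rw [div_lt_iff₀ hδ] at hN
            rw [div_lt_iff₀ hN0]; linarith
          have h0 : 0 < 1 / (N : ℝ) := by positivity
          nlinarith [norm_nonneg (y - x)]) n
        push_cast at st ⊢
        rw [abs_le] at st ih ⊢
        constructor <;> linarith [st.1, st.2, ih.1, ih.2]
    have := ind N
    rw [div_self hN0.ne'] at this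
    simpa using this
  refine ⟨N * (2 * K) + 1, fun n x y => ?_⟩
  obtain ⟨u, hu⟩ := floor_red (y - x)
  have hs : ‖(y + intVec u) - x‖ ≤ 1 := by
    have e : (y + intVec u) - x = y - x + intVec u := by abel
    rw [e]
    simp only [Set.mem_Icc, Prod.le_def] at hu
    obtain ⟨⟨a1, a2⟩, a3, a4⟩ := hu
    rw [Prod.norm_def, max_le_iff, Real.norm_eq_abs, Real.norm_eq_abs, abs_le, abs_le]
    simp only [Prod.fst_zero, Prod.snd_zero, Prod.fst_one, Prod.snd_one] at a1 a2 a3 a4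
    refine ⟨⟨?_, ?_⟩, ?_, ?_⟩ <;> linarith
  have e1 := h3 x _ hs n
  have e2 := (norm_snd_le _).trans hs
  rw [hl] at e1
  rw [Real.norm_eq_abs] at e2
  simp only [Prod.snd_sub, Prod.snd_add, abs_le] at e1 e2 ⊢
  constructor <;> linarith [e1.1, e1.2, e2.1, e2.2]

/-- Lifts that are homeomorphisms form a subgroup. -/
def liftGroup : Subgroup (Equiv.Perm V2) where
  carrier := {e | Continuous ⇑e ∧ Continuous ⇑e.symm ∧ IsLift ⇑e}
  one_mem' := ⟨continuous_id, continuous_id, fun _ _ => rfl⟩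
  mul_mem' := by
    rintro a b ⟨a1, a2, a3⟩ ⟨b1, b2, b3⟩
    refine ⟨a1.comp b1, b2.comp a2, fun z u => ?_⟩
    simp only [Equiv.Perm.mul_apply]
    rw [b3, a3]
  inv_mem' := by
    rintro a ⟨a1, a2, a3⟩
    refine ⟨a2, a1, fun z u => ?_⟩
    apply a.injective
    rw [a3]
    simp

/-- Theorem B, special case: if commuting lifts f, h are such that f is (0,1)-annular and
the deviation of h in the direction (1,0) is unbounded, then the total deviation of f is
finite. -/
theorem stmt13 (f h : Equiv.Perm V2)
    (hfc : Continuous ⇑f) (hfc' : Continuous ⇑f.symm)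
    (hhc : Continuous ⇑h) (hhc' : Continuous ⇑h.symm)
    (hlf : IsLift ⇑f) (hlh : IsLift ⇑h)
    (hcomm : ∀ z : V2, f (h z) = h (f z))
    (M : ℝ) (hM : 0 < M) (hann : ∀ (n : ℤ) (z : V2), |((f ^ n) z - z).1| ≤ M)
    (hdev : ∀ C > 0, ∃ (n : ℤ) (x y : V2), |(((h ^ n) x - x) - ((h ^ n) y - y)).1| > C) :
    ∃ K : ℝ, ∀ (n : ℤ) (x y : V2), nrm (((f ^ n) x - x) - ((f ^ n) y - y)) ≤ K := by
  have hfG : f ∈ liftGroup := ⟨hfc, hfc', hlf⟩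
  have hhG : h ∈ liftGroup := ⟨hhc, hhc', hlh⟩
  have hC : Commute f h := Equiv.ext hcomm
  obtain ⟨m, x, y, hxy⟩ : ∃ (n : ℤ) (x y : V2),
      (((h ^ n) x - x) - ((h ^ n) y - y)).1 > 4 * M + 4 := by
    obtain ⟨n, x, y, hxy⟩ := hdev (4 * M + 4) (by linarith)
    rcases lt_abs.1 hxy with h1 | h1
    · exact ⟨n, x, y, h1⟩
    · refine ⟨n, y, x, ?_⟩
      simp only [Prod.fst_sub] at h1 ⊢
      linarith
  set g := h ^ m with hgdef
  have hgG : g ∈ liftGroup := liftGroup.zpow_mem hhG m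
  obtain ⟨hgc, hgc', hlg⟩ := hgG
  have hlg' : IsLift ⇑g.symm := (liftGroup.inv_mem (liftGroup.zpow_mem hhG m)).2.2
  have hfn : ∀ n : ℤ, f ^ n ∈ liftGroup := fun n => liftGroup.zpow_mem hfG n
  have hCg : ∀ (n : ℤ) z, (f ^ n) (g z) = g ((f ^ n) z) := by
    intro n z
    exact congrArg (fun e : Equiv.Perm V2 => e z) (hC.zpow_zpow n m).eq
  have hCg' : ∀ (n : ℤ) z, g.symm ((f ^ n) z) = (f ^ n) (g.symm z) := by
    intro n z
    rw [Equiv.symm_apply_eq, ← hCg, Equiv.apply_symm_apply]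
  obtain ⟨D, hD⟩ := disp_bdd g hgc hlg
  have hD1 : ∀ z, |(g z - z).1| ≤ D := fun z => (norm_fst_le _).trans (hD z)
  have hD2 : ∀ z, |(g z - z).2| ≤ D := fun z => (norm_snd_le _).trans (hD z)
  have hD0 : 0 ≤ D := (abs_nonneg _).trans (hD1 0)
  have hD1' : ∀ z, |(g.symm z - z).1| ≤ D := by
    intro z
    have := hD1 (g.symm z)
    rw [Equiv.apply_symm_apply, Prod.fst_sub, abs_sub_comm] at this
    simpa using this
  have hD2' : ∀ z, |(g.symm z - z).2| ≤ D := by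
    intro z
    have := hD2 (g.symm z)
    rw [Equiv.apply_symm_apply, Prod.snd_sub, abs_sub_comm] at this
    simpa using this
  have hloc : ∀ z, ∀ᶠ w in 𝓝 z, ∀ n : ℤ, |((f ^ n) z - (f ^ n) w).2| ≤ 4 * D + 2 := by
    intro z
    by_cases hz : (g y - y).1 + 2 * M + 2 < (z - g.symm z).1
    · have := local_bound g g.symm hgc hgc' (by simp) (by simp) hlg D hD1 hD2
        (fun n => ⇑(f ^ n)) (fun n => (hfn n).1) hCg' M hann y z hz
      filter_upwards [this] with w hw n
      linarith [hw n]
    · have := local_bound g.symm g hgc' hgc (by simp) (by simp) hlg' D hD1' hD2'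
        (fun n => ⇑(f ^ n)) (fun n => (hfn n).1) (fun n z => (hCg n z).symm) M hann (g x)
        (g.symm z) (by
          simp only [Equiv.symm_apply_apply, Equiv.apply_symm_apply, Prod.fst_sub] at hz hxy ⊢
          linarith)
      have := hgc'.continuousAt.eventually this
      filter_upwards [this] with w hw n
      have h1 := hw n
      simp only [← hCg'] at h1
      have h2 := hD2' ((f ^ n) z)
      have h3 := hD2' ((f ^ n) w)
      simp only [Prod.snd_sub, abs_le] at h1 h2 h3 ⊢
      constructor <;> linarith [h1.1, h1.2, h2.1, h2.2, h3.1, h3.2]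
  obtain ⟨K', hK'⟩ := glob (fun n => ⇑(f ^ n)) (fun n => (hfn n).2.2) _ hloc
  refine ⟨2 * M + K', fun n x y => ?_⟩
  have h1 : |(((f ^ n) x - x) - ((f ^ n) y - y)).1| ≤ 2 * M := by
    rw [Prod.fst_sub]
    exact (abs_sub _ _).trans (by linarith [hann n x, hann n y])
  have h2 := hK' n x y
  unfold nrm dot
  generalize ((f ^ n) x - x) - ((f ^ n) y - y) = q at h1 h2
  rw [← abs_mul_abs_self q.1, ← abs_mul_abs_self q.2]
  apply Real.sqrt_le_iff.2
  have a1 := abs_nonneg q.1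
  have a2 := abs_nonneg q.2
  constructor
  · linarith
  · nlinarith [mul_nonneg a1 a2]
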